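/- Suppose that for every finite group G (in a fixed universe) a group homomorphism P_G : G → G is given, such that for every group homomorphism f : G → H between finite groups the homomorphisms P_H ∘ f and f ∘ P_G are conjugate, i.e. there exists h ∈ H with P_H(f(g)) = h · f(P_G(g)) · h⁻¹ for all g ∈ G. Then either P_G is the trivial homomorphism (P_G(g) = 1 for all g) for every finite group G, or for every finite group G the homomorphism P_G is conjugate to the identity, i.e. there exists h ∈ G with P_G(g) = h · g · h⁻¹ for all g ∈ G. -/

import Mathlib

universe u

theorem conj_aux {W : Type u} [Group W] (p h a b : W)
    (e : p * (h * a * h⁻¹) = (h * b * h⁻¹) * p) :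
    (h⁻¹ * p * h) * a = b * (h⁻¹ * p * h) := by
  calc (h⁻¹ * p * h) * a = h⁻¹ * (p * (h * a * h⁻¹)) * h := by group
    _ = h⁻¹ * ((h * b * h⁻¹) * p) * h := by rw [e]
    _ = _ := by group

/-- The center of the category of bands (finite groups with conjugacy classes
of homomorphisms as morphisms) is the multiplicative monoid `{0, 1}`. -/
theorem center_of_category_of_bands
    (P : ∀ (G : Type u) [Group G] [Finite G], G →* G)
    (hP : ∀ (G : Type u) [Group G] [Finite G] (H : Type u) [Group H] [Finite H]
      (f : G →* H), ∃ h : H, ∀ g : G, P H (f g) = h * f (P G g) * h⁻¹) :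
    (∀ (G : Type u) [Group G] [Finite G] (g : G), P G g = 1) ∨
    (∀ (G : Type u) [Group G] [Finite G], ∃ h : G, ∀ g : G, P G g = h * g * h⁻¹) := by
  classical
  let C : Type u := Multiplicative (ULift.{u} (ZMod 2))
  let t : C := Multiplicative.ofAdd (ULift.up 1)
  have ht1 : t ≠ 1 := by
    intro h
    have : (1 : ZMod 2) = 0 := congrArg (fun c : C => (Multiplicative.toAdd c).down) h
    exact absurd this (by decide)
  have hC : ∀ c : C, c = 1 ∨ c = t := by
    have key : ∀ z : ZMod 2, z = 0 ∨ z = 1 := by decide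
    intro c
    rcases key (Multiplicative.toAdd c).down with h | h
    · left
      exact congrArg (fun z => (Multiplicative.ofAdd (ULift.up z) : C)) h
    · right
      exact congrArg (fun z => (Multiplicative.ofAdd (ULift.up z) : C)) h
  have : Finite C := inferInstanceAs (Finite (Multiplicative (ULift.{u} (ZMod 2))))
  rcases hC (P C t) with h0 | h1
  · left
    -- every involution is killed
    have inv : ∀ (G : Type u) [Group G] [Finite G] (s : G), s * s = 1 → P G s = 1 := by
      intro G _ _ s hs
      let f0 : ZMod 2 →+ Additive G := ZMod.lift 2 ⟨zmultiplesHom (Additive G) (Additive.ofMul s), by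
        simp [two_zsmul, ← ofMul_mul, hs]⟩
      let f : C →* G := AddMonoidHom.toMultiplicativeLeft
        (f0.comp (AddEquiv.ulift (α := ZMod 2)).toAddMonoidHom)
      have hf : f t = s := by
        change Additive.toMul (f0 1) = s
        have : f0 ((1 : ℤ) : ZMod 2) = _ := ZMod.lift_coe 2 _ 1
        have h3 : f0 1 = Additive.ofMul s := by simpa using this
        rw [h3]; rfl
      obtain ⟨h, hh⟩ := hP C G f
      have := hh t
      rw [hf, h0] at this
      simpa using this
    intro G _ _ g
    have hS : ∀ σ : Equiv.Perm G, P (Equiv.Perm G) σ = 1 := by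
      intro σ
      have := Fintype.ofFinite G
      induction σ using Equiv.Perm.swap_induction_on with
      | one => simp
      | swap_mul σ x y hxy ih =>
        rw [map_mul, ih, inv _ _ (Equiv.swap_mul_self x y), one_mul]
    obtain ⟨h, hh⟩ := hP G (Equiv.Perm G) (MulAction.toPermHom G G)
    have := hh g
    rw [hS] at this
    have h2 : MulAction.toPermHom G G (P G g) = 1 := by
      have h3 := congrArg (fun z => h⁻¹ * z * h) this
      simpa [mul_assoc] using h3.symm
    have := congrArg (fun σ : Equiv.Perm G => σ 1) h2
    simpa using this
  · right
    have hid : ∀ c : C, P C c = c := by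
      intro c
      rcases hC c with h | h
      · rw [h, map_one]
      · rw [h, h1]
    intro G _ _
    have hV : ∀ v : G → C, P (G → C) v = v := by
      intro v
      funext x
      obtain ⟨h, hh⟩ := hP (G → C) C (Pi.evalMonoidHom (fun _ => C) x)
      have := hh v
      rw [hid, mul_comm h, mul_inv_cancel_right] at this
      exact this.symm
    let W := RegularWreathProduct C G
    have : Finite W := Finite.of_injective
      (fun w : W => (w.left, w.right)) (by
        intro a b hab
        simp only [Prod.mk.injEq] at hab
        exact RegularWreathProduct.ext hab.1 hab.2)
    let i : (G → C) →* W :=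
      { toFun := fun v => ⟨v, 1⟩
        map_one' := rfl
        map_mul' := by
          intro a b
          refine RegularWreathProduct.ext (funext fun x => ?_) ?_
          · change a x * b x = a x * b (1⁻¹ * x)
            rw [inv_one, one_mul]
          · change (1 : G) = 1 * 1
            rw [one_mul] }
    obtain ⟨h, hh⟩ := hP (G → C) W i
    obtain ⟨a, ha⟩ := hP W G RegularWreathProduct.rightHom
    refine ⟨a * h.right, fun g => ?_⟩
    let j : W := ⟨1, g⟩
    let v : G → C := fun x => if x = 1 then t else 1
    let v' : G → C := fun x => v (g⁻¹ * x)
    have e1 : j * i v = i v' * j := by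
      refine RegularWreathProduct.ext (funext fun x => ?_) ?_
      · change 1 * v (g⁻¹ * x) = v (g⁻¹ * x) * 1
        rw [one_mul, mul_one]
      · change g * 1 = 1 * g
        rw [one_mul, mul_one]
    have e2 : P W j * (h * i v * h⁻¹) = (h * i v' * h⁻¹) * P W j := by
      have := congrArg (P W) e1
      rw [map_mul, map_mul, hh, hh, hV, hV] at this
      exact this
    let c : W := h⁻¹ * P W j * h
    have e3 : c * i v = i v' * c := by
      exact conj_aux _ _ _ _ e2
    have e4 : c.right = g := by
      have h5 := congrFun (congrArg RegularWreathProduct.left e3) g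
      have h6 : c.left g * v (c.right⁻¹ * g) = v (g⁻¹ * g) * c.left (1⁻¹ * g) := h5
      rw [inv_one, one_mul, mul_comm, mul_left_inj] at h6
      by_contra hne
      have hne' : c.right⁻¹ * g ≠ 1 := by
        intro h7
        exact hne (inv_mul_eq_one.mp h7)
      simp only [v, hne', if_false, inv_mul_cancel, if_true] at h6
      exact ht1 h6.symm
    have e5 : h.right⁻¹ * (P W j).right * h.right = g := e4
    have e6 : (P W j).right = h.right * g * h.right⁻¹ := by
      rw [← e5]; group
    have e7 : P G g = a * (P W j).right * a⁻¹ := ha j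
    rw [e7, e6]; group
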